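/- arXiv:2202.07527 — 2 statements merged into one kernel-verified Lean document; each statement's English description precedes it below -/
import Mathlib

section
/- Let U_1,...,U_n be independent uniform random variables on [-1,1] and X = (1/n)∑ U_i. Then for every t in [0,1), the truncated mean satisfies m_X(t) ≤ t + sqrt(E[X^2]) = t + 1/sqrt(3n). -/
open MeasureTheory Set

/-- The distribution of `n` i.i.d. uniform random variables on `[-1,1]`. -/
noncomputable def unifCube (n : ℕ) : Measure (Fin n → ℝ) :=
  Measure.pi fun _ => (2 : ENNReal)⁻¹ • volume.restrict (Icc (-1 : ℝ) 1)

/-- `X = (1/n) ∑ᵢ Uᵢ`, the average of the coordinates. -/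
noncomputable def avgCoord (n : ℕ) (u : Fin n → ℝ) : ℝ := (∑ i, u i) / n

/-- `p_X(t) = P(X > t)`. -/
noncomputable def tailP (n : ℕ) (t : ℝ) : ℝ :=
  (unifCube n {u | t < avgCoord n u}).toReal

/-- `m_X(t) = E[X ∣ X > t]`, the truncated mean. -/
noncomputable def truncMean (n : ℕ) (t : ℝ) : ℝ :=
  (∫ u in {u | t < avgCoord n u}, avgCoord n u ∂(unifCube n)) / tailP n t

/-- The uniform distribution on `[-1,1]`. -/
noncomputable def unifSymm : Measure ℝ := (2 : ENNReal)⁻¹ • volume.restrict (Icc (-1 : ℝ) 1)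

instance isProbabilityMeasure_unifSymm : IsProbabilityMeasure unifSymm := by
  constructor
  norm_num [unifSymm]
  exact ENNReal.inv_mul_cancel (by simp) (by simp)

theorem unifCube_eq_pi (n : ℕ) : unifCube n = Measure.pi fun _ => unifSymm := rfl

instance isProbabilityMeasure_unifCube (n : ℕ) : IsProbabilityMeasure (unifCube n) := by
  rw [unifCube_eq_pi]; infer_instance

theorem integral_unifSymm (f : ℝ → ℝ) : ∫ x, f x ∂unifSymm = (∫ x in (-1)..1, f x) / 2 := by
  rw [unifSymm, integral_smul_measure, intervalIntegral.integral_of_le (by norm_num),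
    integral_Icc_eq_integral_Ioc]
  simp [div_eq_inv_mul]

theorem memLp_id_unifSymm : MemLp id 2 unifSymm := by
  refine MemLp.of_bound aestronglyMeasurable_id 1 ?_
  refine Measure.ae_smul_measure ?_ _
  filter_upwards [ae_restrict_mem measurableSet_Icc] with x hx
  exact abs_le.2 hx

theorem integral_id_unifSymm : ∫ x, id x ∂unifSymm = 0 := by
  rw [integral_unifSymm]; simp

theorem variance_id_unifSymm : ProbabilityTheory.variance id unifSymm = 1 / 3 := by
  rw [ProbabilityTheory.variance_of_integral_eq_zero aemeasurable_id integral_id_unifSymm,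
    integral_unifSymm]
  norm_num

theorem memLp_eval_unifCube (n : ℕ) (i : Fin n) : MemLp (fun u => u i) 2 (unifCube n) :=
  memLp_id_unifSymm.comp_measurePreserving (measurePreserving_eval (fun _ => unifSymm) i)

theorem memLp_sum_unifCube (n : ℕ) : MemLp (fun u => ∑ i, u i) 2 (unifCube n) :=
  memLp_finsetSum _ fun i _ => memLp_eval_unifCube n i

theorem integrable_sum_unifCube (n : ℕ) : Integrable (fun u => ∑ i, u i) (unifCube n) :=
  (memLp_sum_unifCube n).integrable (by norm_num)

theorem integral_sum_unifCube (n : ℕ) : ∫ u, ∑ i, u i ∂unifCube n = 0 := by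
  rw [integral_finsetSum _ fun i _ => (memLp_eval_unifCube n i).integrable (by norm_num)]
  refine Finset.sum_eq_zero fun i _ => ?_
  rw [← integral_id_unifSymm]
  exact integral_comp_eval (μ := fun _ => unifSymm) aestronglyMeasurable_id

theorem integral_sum_sq_unifCube (n : ℕ) : ∫ u, (∑ i, u i) ^ 2 ∂unifCube n = n / 3 := by
  have h := ProbabilityTheory.variance_sum_pi (μ := fun _ : Fin n => unifSymm)
    (X := fun _ => id) fun _ => memLp_id_unifSymm
  have hS : (∑ i, fun ω : Fin n → ℝ => id (ω i)) = fun u => ∑ i, u i := by ext; simp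
  rw [hS, ← unifCube_eq_pi, ProbabilityTheory.variance_of_integral_eq_zero
    (integrable_sum_unifCube n).aemeasurable (integral_sum_unifCube n)] at h
  simp only [variance_id_unifSymm, Finset.sum_const, Finset.card_univ, Fintype.card_fin,
    nsmul_eq_mul] at h
  rw [h]; ring

theorem integral_avgCoord_sq (n : ℕ) (hn : 0 < n) :
    ∫ u, avgCoord n u ^ 2 ∂unifCube n = 1 / (3 * n) := by
  simp only [avgCoord, div_pow]
  rw [integral_div, integral_sum_sq_unifCube]
  field_simp

/-- `E[f (S - t)]`, where `S` is the sum of `n` independent uniform variables on `[-1,1]`. -/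
noncomputable def shiftMean (f : ℝ → ℝ) (n : ℕ) (t : ℝ) : ℝ :=
  ∫ u, f (∑ i, u i - t) ∂unifCube n

section shiftMean

variable {f : ℝ → ℝ}

theorem integrable_comp_sum_sub (hf : Monotone f) (hb : ∀ s, |f s| ≤ 1 + |s|) (n : ℕ) (t : ℝ) :
    Integrable (fun u => f (∑ i, u i - t)) (unifCube n) := by
  have hS : Measurable fun u : Fin n → ℝ => ∑ i, u i - t := by fun_prop
  refine Integrable.mono' ((integrable_const (1 : ℝ)).add
    ((integrable_sum_unifCube n).sub (integrable_const t)).abs)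
    (hf.measurable.comp hS).aestronglyMeasurable ?_
  exact .of_forall fun u => hb _

theorem antitone_shiftMean (hf : Monotone f) (hb : ∀ s, |f s| ≤ 1 + |s|) (n : ℕ) :
    Antitone (shiftMean f n) := fun s t hst =>
  integral_mono (integrable_comp_sum_sub hf hb n t) (integrable_comp_sum_sub hf hb n s)
    fun _ => hf (by linarith)

theorem shiftMean_succ (hf : Monotone f) (hb : ∀ s, |f s| ≤ 1 + |s|) (n : ℕ) (t : ℝ) :
    shiftMean f (n + 1) t = (∫ s in (t - 1)..(t + 1), shiftMean f n s) / 2 := by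
  have hmp := measurePreserving_piFinSuccAbove (fun _ : Fin (n + 1) => unifSymm) 0
  let F : ℝ × (Fin n → ℝ) → ℝ := fun p => f (∑ i, p.2 i - (t - p.1))
  have hsum : (fun u : Fin (n + 1) → ℝ => f (∑ i, u i - t)) =
      F ∘ MeasurableEquiv.piFinSuccAbove (fun _ => ℝ) 0 := by
    ext u
    simp only [F, Function.comp_apply, Fin.sum_univ_succ, MeasurableEquiv.piFinSuccAbove_apply]
    congr 1
    simp [Fin.insertNthEquiv, Fin.tail]
    ring
  have hint := integrable_comp_sum_sub hf hb (n + 1) t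
  rw [hsum] at hint
  have hint' : Integrable F (unifSymm.prod (Measure.pi fun _ => unifSymm)) :=
    (hmp.integrable_comp_emb (MeasurableEquiv.measurableEmbedding _)).1 hint
  rw [shiftMean, hsum, unifCube_eq_pi]
  refine (hmp.integral_comp' F).trans ?_
  rw [integral_prod _ hint', integral_unifSymm]
  change (∫ x in (-1)..1, shiftMean f n (t - x)) / 2 = _
  rw [intervalIntegral.integral_comp_sub_left, sub_neg_eq_add]

end shiftMean

theorem intervalIntegral_mul_le_of_le {F G : ℝ → ℝ} {a b c d : ℝ}
    (hF : ∀ a b, IntervalIntegrable F volume a b) (hG : ∀ a b, IntervalIntegrable G volume a b)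
    (h : ∀ x y, x ≤ y → F x * G y ≤ F y * G x) (hab : a ≤ b) (hbc : b ≤ c) (hcd : c ≤ d) :
    (∫ x in a..b, F x) * (∫ y in c..d, G y) ≤ (∫ y in c..d, F y) * ∫ x in a..b, G x := by
  rw [← intervalIntegral.integral_mul_const, ← intervalIntegral.integral_const_mul]
  refine intervalIntegral.integral_mono_on hab ((hF _ _).mul_const _) ((hG _ _).const_mul _)
    fun x hx => ?_
  rw [← intervalIntegral.integral_mul_const, ← intervalIntegral.integral_const_mul]
  exact intervalIntegral.integral_mono_on hcd ((hG _ _).const_mul _) ((hF _ _).mul_const _)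
    fun y hy => h x y (by linarith [hx.2, hy.1])

/-- Averaging over a sliding window preserves the monotonicity of a ratio. -/
theorem window_integral_mul_le {F G : ℝ → ℝ}
    (hF : ∀ a b, IntervalIntegrable F volume a b) (hG : ∀ a b, IntervalIntegrable G volume a b)
    (h : ∀ x y, x ≤ y → F x * G y ≤ F y * G x) {r x y : ℝ} (hr : 0 ≤ r) (hxy : x ≤ y) :
    (∫ s in (x - r)..(x + r), F s) * (∫ s in (y - r)..(y + r), G s) ≤
      (∫ s in (y - r)..(y + r), F s) * ∫ s in (x - r)..(x + r), G s := by
  rcases le_total (x + r) (y - r) with hd | hd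
  · exact intervalIntegral_mul_le_of_le hF hG h (by linarith) hd (by linarith)
  · rw [← intervalIntegral.integral_add_adjacent_intervals (hF (x - r) (y - r)) (hF _ (x + r)),
      ← intervalIntegral.integral_add_adjacent_intervals (hG (x - r) (y - r)) (hG _ (x + r)),
      ← intervalIntegral.integral_add_adjacent_intervals (hF (y - r) (x + r)) (hF _ (y + r)),
      ← intervalIntegral.integral_add_adjacent_intervals (hG (y - r) (x + r)) (hG _ (y + r))]
    have h₁ := intervalIntegral_mul_le_of_le hF hG h (sub_le_sub_right hxy r) le_rfl hd
    have h₂ := intervalIntegral_mul_le_of_le hF hG h hd le_rfl (add_le_add_left hxy r)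
    have h₃ := intervalIntegral_mul_le_of_le hF hG h (sub_le_sub_right hxy r) hd
      (add_le_add_left hxy r)
    linarith

/-- The indicator of the positive half-line. -/
noncomputable def posInd : ℝ → ℝ := (Ioi 0).indicator 1

theorem monotone_posInd : Monotone posInd := by
  intro a b hab
  unfold posInd
  by_cases ha : 0 < a
  · simp [ha, ha.trans_le hab]
  · rw [indicator_of_notMem (by simpa using ha)]
    exact indicator_nonneg (fun _ _ => zero_le_one) b

theorem abs_posInd_le (s : ℝ) : |posInd s| ≤ 1 + |s| := by
  unfold posInd
  by_cases hs : 0 < s <;> simp only [hs, indicator, mem_Ioi, if_true, if_false,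
    Pi.one_apply, abs_one, abs_zero]
  · linarith [abs_nonneg s]
  · positivity

theorem monotone_max_zero : Monotone fun s : ℝ => max s 0 :=
  monotone_id.max monotone_const

theorem abs_max_zero_le (s : ℝ) : |max s 0| ≤ 1 + |s| := by
  rw [abs_of_nonneg (le_max_right s 0)]
  exact max_le (by linarith [le_abs_self s]) (by positivity)

/-- The mean residual life `E[S - t ∣ S > t]` is nonincreasing in `t`. -/
theorem shiftMean_mul_le (n : ℕ) : ∀ x y : ℝ, x ≤ y →
    shiftMean posInd n x * shiftMean (fun s => max s 0) n y ≤
      shiftMean posInd n y * shiftMean (fun s => max s 0) n x := by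
  induction n with
  | zero =>
    intro x y hxy
    simp only [shiftMean, Finset.univ_eq_empty, Finset.sum_empty, zero_sub, integral_const,
      probReal_univ, one_smul, posInd]
    rcases le_or_gt 0 y with hy | hy
    · simp [hy, hy.not_gt]
    · have hx := hxy.trans_lt hy
      simpa [hx, hy, hx.le, hy.le] using hxy
  | succ n ih =>
    intro x y hxy
    have hF := antitone_shiftMean monotone_posInd abs_posInd_le n
    have hG := antitone_shiftMean monotone_max_zero abs_max_zero_le n
    have h := window_integral_mul_le (fun _ _ => hF.intervalIntegrable)
      (fun _ _ => hG.intervalIntegrable) ih zero_le_one hxy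
    simp only [shiftMean_succ monotone_posInd abs_posInd_le,
      shiftMean_succ monotone_max_zero abs_max_zero_le]
    linarith

theorem shiftMean_posInd_add_neg (n : ℕ) (x : ℝ) (hx : n = 0 → x ≠ 0) :
    shiftMean posInd n x + shiftMean posInd n (-x) = 1 := by
  induction n generalizing x with
  | zero =>
    simp only [shiftMean, Finset.univ_eq_empty, Finset.sum_empty, zero_sub, integral_const,
      probReal_univ, one_smul, posInd]
    rcases (hx rfl).lt_or_gt with h | h <;> simp [h, h.not_gt]
  | succ n ih =>
    have hF := antitone_shiftMean monotone_posInd abs_posInd_le n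
    have hF' : Monotone fun s => shiftMean posInd n (-s) := fun a b hab => hF (neg_le_neg hab)
    rw [shiftMean_succ monotone_posInd abs_posInd_le, shiftMean_succ monotone_posInd abs_posInd_le,
      show -x - 1 = -(x + 1) by ring, show -x + 1 = -(x - 1) by ring,
      ← intervalIntegral.integral_comp_neg, ← add_div,
      ← intervalIntegral.integral_add hF.intervalIntegrable hF'.intervalIntegrable]
    have hae : ∀ᵐ s : ℝ, s ∈ uIoc (x - 1) (x + 1) →
        shiftMean posInd n s + shiftMean posInd n (-s) = 1 := by
      filter_upwards [Measure.ae_ne volume (0 : ℝ)] with s hs _ using ih s fun _ => hs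
    rw [intervalIntegral.integral_congr_ae hae]
    norm_num

theorem shiftMean_posInd_zero {n : ℕ} (hn : 0 < n) : shiftMean posInd n 0 = 1 / 2 := by
  have h := shiftMean_posInd_add_neg n 0 fun h => absurd h hn.ne'
  rw [neg_zero] at h
  linarith

theorem integral_abs_sum_le (n : ℕ) : ∫ u, |∑ i, u i| ∂unifCube n ≤ √(n / 3) := by
  have h := ProbabilityTheory.variance_nonneg |fun u : Fin n → ℝ => ∑ i, u i| (unifCube n)
  rw [ProbabilityTheory.variance_eq_sub (memLp_sum_unifCube n).abs] at h
  refine Real.le_sqrt_of_sq_le ?_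
  rw [← integral_sum_sq_unifCube]
  simpa using h

theorem shiftMean_max_zero_zero_le (n : ℕ) :
    shiftMean (fun s => max s 0) n 0 ≤ √(n / 3) / 2 := by
  have hS := integrable_sum_unifCube n
  have h (u : Fin n → ℝ) : max (∑ i, u i - 0) 0 = (∑ i, u i + |∑ i, u i|) / 2 := by
    rcases le_total 0 (∑ i, u i) with h | h
    · simp [h, abs_of_nonneg h]
    · simp [h, abs_of_nonpos h]
  simp only [shiftMean, h]
  rw [integral_div, integral_add hS hS.abs, integral_sum_unifCube, zero_add]
  linarith [integral_abs_sum_le n]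

theorem setOf_lt_avgCoord {n : ℕ} (hn : 0 < n) (t : ℝ) :
    {u | t < avgCoord n u} = {u : Fin n → ℝ | n * t < ∑ i, u i} := by
  ext u
  simp only [avgCoord, mem_ofPred_eq]
  rw [lt_div_iff₀ (by positivity), mul_comm]

theorem measurableSet_lt_sum (n : ℕ) (s : ℝ) : MeasurableSet {u : Fin n → ℝ | s < ∑ i, u i} :=
  measurableSet_lt measurable_const (by fun_prop)

theorem tailP_eq_shiftMean {n : ℕ} (hn : 0 < n) (t : ℝ) :
    tailP n t = shiftMean posInd n (n * t) := by
  rw [tailP, setOf_lt_avgCoord hn, ← measureReal_def,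
    ← integral_indicator_one (measurableSet_lt_sum n _)]
  refine integral_congr_ae (.of_forall fun u => ?_)
  simp [posInd, indicator]

theorem setIntegral_avgCoord_eq {n : ℕ} (hn : 0 < n) (t : ℝ) :
    ∫ u in {u | t < avgCoord n u}, avgCoord n u ∂unifCube n =
      t * tailP n t + shiftMean (fun s => max s 0) n (n * t) / n := by
  have hn' : (n : ℝ) ≠ 0 := by positivity
  rw [tailP_eq_shiftMean hn, setOf_lt_avgCoord hn, ← integral_indicator (measurableSet_lt_sum n _),
    shiftMean, shiftMean, ← integral_const_mul, ← integral_div, ← integral_add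
      ((integrable_comp_sum_sub monotone_posInd abs_posInd_le n _).const_mul _)
      ((integrable_comp_sum_sub monotone_max_zero abs_max_zero_le n _).div_const _)]
  refine integral_congr_ae (.of_forall fun u => ?_)
  by_cases h : n * t < ∑ i, u i
  · have h' : max (∑ i, u i - n * t) 0 = ∑ i, u i - n * t := max_eq_left (by linarith)
    simp [posInd, indicator, h, h', avgCoord]
    field_simp
    ring
  · have h' : max (∑ i, u i - n * t) 0 = 0 := max_eq_right (by linarith)
    simp [posInd, indicator, h, h']

theorem truncMean_le {n : ℕ} (hn : 0 < n) {t : ℝ} (ht : 0 ≤ t) :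
    truncMean n t ≤ t + 1 / √(3 * n) := by
  have hn' : (0 : ℝ) < n := by positivity
  have hG : 0 ≤ tailP n t := ENNReal.toReal_nonneg
  have hmul := shiftMean_mul_le n 0 (n * t) (by positivity)
  rw [shiftMean_posInd_zero hn, ← tailP_eq_shiftMean hn] at hmul
  have hle := mul_le_mul_of_nonneg_left (shiftMean_max_zero_zero_le n) hG
  have hsqrt : √((n : ℝ) / 3) = n * (1 / √(3 * n)) := by
    rw [show (n : ℝ) / 3 = n ^ 2 / (3 * n) by field_simp, Real.sqrt_div (by positivity),
      Real.sqrt_sq hn'.le]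
    ring
  rw [hsqrt] at hle
  have hdiv : shiftMean (fun s => max s 0) n (n * t) / n ≤ tailP n t * (1 / √(3 * n)) := by
    rw [div_le_iff₀ hn']
    linarith
  rw [truncMean, setIntegral_avgCoord_eq hn]
  refine div_le_of_le_mul₀ hG (by positivity) ?_
  linarith

/-- For the average `X` of `n` i.i.d. uniform random variables on `[-1,1]`,
`E[X²] = 1/(3n)` and for every `t ∈ [0,1)`,
`m_X(t) ≤ t + √(E[X²]) = t + 1/√(3n)`. -/
theorem truncMean_le_add_sqrt_var (n : ℕ) (hn : 0 < n) :
    (∫ u, (avgCoord n u) ^ 2 ∂(unifCube n)) = 1 / (3 * n) ∧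
    ∀ t ∈ Ico (0 : ℝ) 1,
      truncMean n t ≤ t + Real.sqrt (∫ u, (avgCoord n u) ^ 2 ∂(unifCube n)) ∧
      truncMean n t ≤ t + 1 / Real.sqrt (3 * n) := by
  refine ⟨integral_avgCoord_sq n hn, fun t ht => ⟨?_, truncMean_le hn ht.1⟩⟩
  rw [integral_avgCoord_sq n hn, Real.sqrt_div zero_le_one, Real.sqrt_one]
  exact truncMean_le hn ht.1
end

section
/- There is a universal constant C > 0 such that for every positive integer n, if X = (1/n)∑ U_i with U_1,...,U_n independent uniform on [-1,1], then for every t in (-1,1), (m_X(t) - t) · m_X(t)/(1 - m_X(t)^2) < C/n. -/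
open MeasureTheory Set

/-- The uniform distribution on `[-1,1]`. -/
noncomputable def unifInterval : Measure ℝ :=
  (2 : ENNReal)⁻¹ • volume.restrict (Icc (-1 : ℝ) 1)

instance : IsProbabilityMeasure unifInterval := by
  refine ⟨?_⟩
  simp only [unifInterval, Measure.smul_apply, Measure.restrict_apply_univ, Real.volume_Icc,
    smul_eq_mul]
  norm_num
  exact ENNReal.inv_mul_cancel (by norm_num) (by norm_num)

instance (n : ℕ) : IsProbabilityMeasure (unifCube n) :=
  inferInstanceAs (IsProbabilityMeasure (Measure.pi fun _ : Fin n => unifInterval))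

theorem ae_mem_Icc_unifInterval : ∀ᵐ x ∂unifInterval, x ∈ Icc (-1 : ℝ) 1 :=
  Measure.ae_smul_measure (ae_restrict_mem measurableSet_Icc) _

theorem ae_mem_Icc_unifCube (n : ℕ) : ∀ᵐ u ∂unifCube n, ∀ i, u i ∈ Icc (-1 : ℝ) 1 := by
  rw [ae_all_iff]
  intro i
  exact (Measure.quasiMeasurePreserving_eval (fun _ : Fin n => unifInterval) i).ae
    ae_mem_Icc_unifInterval

theorem integral_unifInterval (f : ℝ → ℝ) :
    ∫ x, f x ∂unifInterval = 2⁻¹ * ∫ x in (-1 : ℝ)..1, f x := by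
  rw [unifInterval, integral_smul_measure, intervalIntegral.integral_of_le (by norm_num),
    integral_Icc_eq_integral_Ioc]
  simp

/-- The Stein identity of the uniform distribution, for the test function `x ↦ (a x + c)⁺`. -/
theorem integral_unifInterval_stein {a : ℝ} (ha : 0 < a) (c : ℝ) :
    ∫ x, {x : ℝ | 0 < a * x + c}.indicator
      (fun x => 2 * x * (a * x + c) - a * (1 - x ^ 2)) x ∂unifInterval = 0 := by
  have hmeas : MeasurableSet {x : ℝ | 0 < a * x + c} :=
    (isOpen_lt continuous_const (by fun_prop)).measurableSet
  have key := integral_eq_of_hasDerivAt_off_countable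
    (a := -1) (b := 1) (fun x : ℝ => (x ^ 2 - 1) * max (a * x + c) 0)
    (({x : ℝ | 0 < a * x + c}.indicator fun x => 2 * x * (a * x + c) - a * (1 - x ^ 2)))
    (countable_singleton (-c / a)) (by fun_prop) ?_ ?_
  · rw [integral_unifInterval, key]
    norm_num
  · rintro x ⟨-, hx⟩
    rcases lt_trichotomy (a * x + c) 0 with h | h | h
    · rw [indicator_of_notMem (by simpa using h.le)]
      refine (hasDerivAt_const x (0 : ℝ)).congr_of_eventuallyEq ?_
      filter_upwards [(isOpen_lt (by fun_prop) continuous_const).mem_nhds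
        (show x ∈ {x : ℝ | a * x + c < 0} from h)] with y hy
      rw [max_eq_right (le_of_lt hy), mul_zero]
    · exact absurd (show x = -c / a by field_simp; linarith) hx
    · rw [indicator_of_mem (by exact h)]
      have hd : HasDerivAt (fun x : ℝ => (x ^ 2 - 1) * (a * x + c))
          (2 * x * (a * x + c) - a * (1 - x ^ 2)) x := by
        refine (((hasDerivAt_pow 2 x).sub_const 1).mul
          (((hasDerivAt_id x).const_mul a).add_const c)).congr_deriv ?_
        simp only [id, Nat.cast_ofNat, Nat.add_one_sub_one, pow_one]
        ring
      refine hd.congr_of_eventuallyEq ?_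
      filter_upwards [(isOpen_lt continuous_const (by fun_prop)).mem_nhds
        (show x ∈ {x : ℝ | 0 < a * x + c} from h)] with y hy
      rw [max_eq_left (le_of_lt hy)]
  · have hc : Continuous fun x : ℝ => 2 * x * (a * x + c) - a * (1 - x ^ 2) := by fun_prop
    exact ⟨(hc.intervalIntegrable (-1) 1).1.indicator hmeas,
      (hc.intervalIntegrable (-1) 1).2.indicator hmeas⟩

theorem continuous_avgCoord (n : ℕ) : Continuous (avgCoord n) := by
  unfold avgCoord
  fun_prop

theorem measurableSet_lt_avgCoord (n : ℕ) (t : ℝ) : MeasurableSet {u | t < avgCoord n u} :=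
  (isOpen_lt continuous_const (continuous_avgCoord n)).measurableSet

theorem integrable_unifCube_of_continuous {n : ℕ} {f : (Fin n → ℝ) → ℝ} (hf : Continuous f) :
    Integrable f (unifCube n) := by
  obtain ⟨B, hB⟩ := (isCompact_univ_pi fun _ : Fin n => isCompact_Icc (a := (-1 : ℝ)) (b := 1))
    |>.exists_bound_of_continuousOn hf.continuousOn
  refine Integrable.of_bound hf.aestronglyMeasurable B ?_
  filter_upwards [ae_mem_Icc_unifCube n] with u hu
  exact hB u fun i _ => hu i

/-- The Stein identity in one coordinate of the cube. -/
theorem setIntegral_unifCube_stein {n : ℕ} (hn : 0 < n) (t : ℝ) (i : Fin n) :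
    ∫ u in {u | t < avgCoord n u},
      (2 * u i * (avgCoord n u - t) - (1 / n : ℝ) * (1 - u i ^ 2)) ∂unifCube n = 0 := by
  obtain ⟨k, rfl⟩ := Nat.exists_eq_succ_of_ne_zero hn.ne'
  have hmeas := measurableSet_lt_avgCoord (k + 1) t
  set F : (Fin (k + 1) → ℝ) → ℝ := {u | t < avgCoord (k + 1) u}.indicator fun u =>
    2 * u i * (avgCoord (k + 1) u - t) - (1 / (k + 1 : ℕ) : ℝ) * (1 - u i ^ 2) with hF
  have hFint : Integrable F (unifCube (k + 1)) :=
    (integrable_unifCube_of_continuous (by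
      have := continuous_avgCoord (k + 1)
      fun_prop)).indicator hmeas
  have hmp : MeasurePreserving (MeasurableEquiv.piFinSuccAbove (fun _ => ℝ) i).symm
      (unifInterval.prod (Measure.pi fun _ : Fin k => unifInterval)) (unifCube (k + 1)) :=
    (measurePreserving_piFinSuccAbove (fun _ : Fin (k + 1) => unifInterval) i).symm
  rw [← integral_indicator hmeas, ← hF, ← hmp.integral_comp' F, integral_prod_symm]
  · refine integral_eq_zero_of_ae (Filter.Eventually.of_forall fun v => ?_)
    have havg (x : ℝ) : avgCoord (k + 1) (i.insertNth x v) - t =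
        (1 / (k + 1 : ℕ) : ℝ) * x + ((∑ j, v j) / (k + 1 : ℕ) - t) := by
      simp only [avgCoord, Fin.sum_univ_succAbove _ i, Fin.insertNth_apply_same,
        Fin.insertNth_apply_succAbove]
      ring
    refine Eq.trans (integral_congr_ae (Filter.Eventually.of_forall fun x => ?_))
      (integral_unifInterval_stein (a := 1 / (k + 1 : ℕ)) (by positivity)
        ((∑ j, v j) / (k + 1 : ℕ) - t))
    change F (i.insertNth x v) = _
    simp only [hF, indicator, mem_ofPred_eq, ← havg, sub_pos, Fin.insertNth_apply_same]
  · exact (hmp.integrable_comp_emb (MeasurableEquiv.measurableEmbedding _)).2 hFint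

theorem avgCoord_sq_le {n : ℕ} (hn : 0 < n) (u : Fin n → ℝ) :
    avgCoord n u ^ 2 ≤ (∑ i, u i ^ 2) / n := by
  have h := sq_sum_le_card_mul_sum_sq (s := Finset.univ) (f := u)
  rw [Finset.card_univ, Fintype.card_fin] at h
  have hn' : (0 : ℝ) < n := by exact_mod_cast hn
  rw [avgCoord, div_pow, div_le_div_iff₀ (by positivity) hn']
  nlinarith

/-- The second moment bound `E[X (X - t); X > t] ≤ E[1 - X²; X > t] / (2 n)`. -/
theorem setIntegral_avgCoord_mul_sub_le {n : ℕ} (hn : 0 < n) (t : ℝ) :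
    ∫ u in {u | t < avgCoord n u}, 2 * n * (avgCoord n u * (avgCoord n u - t)) ∂unifCube n ≤
      ∫ u in {u | t < avgCoord n u}, (1 - avgCoord n u ^ 2) ∂unifCube n := by
  have hn' : (0 : ℝ) < n := by exact_mod_cast hn
  have hc := continuous_avgCoord n
  have hsum : ∫ u in {u | t < avgCoord n u}, ∑ i,
      (2 * u i * (avgCoord n u - t) - (1 / n : ℝ) * (1 - u i ^ 2)) ∂unifCube n = 0 := by
    rw [integral_finsetSum _ fun i _ =>
      (integrable_unifCube_of_continuous (by fun_prop)).integrableOn]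
    exact Finset.sum_eq_zero fun i _ => setIntegral_unifCube_stein hn t i
  rw [← sub_nonpos, ← integral_sub
    (integrable_unifCube_of_continuous (by fun_prop)).integrableOn
    (integrable_unifCube_of_continuous (by fun_prop)).integrableOn, ← hsum]
  refine integral_mono (integrable_unifCube_of_continuous (by fun_prop)).integrableOn
    (integrable_unifCube_of_continuous (by fun_prop)).integrableOn fun u => ?_
  have hX : ∑ i, u i = n * avgCoord n u := by
    rw [avgCoord]
    field_simp
  have hexp : ∑ i, (2 * u i * (avgCoord n u - t) - (1 / n : ℝ) * (1 - u i ^ 2)) =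
      2 * (n * avgCoord n u) * (avgCoord n u - t) - (1 - (∑ i, u i ^ 2) / n) := by
    rw [Finset.sum_sub_distrib, ← Finset.sum_mul, ← Finset.mul_sum, ← Finset.mul_sum,
      Finset.sum_sub_distrib, hX]
    simp
    field_simp
  simp only [hexp]
  linarith [avgCoord_sq_le hn u]

theorem setIntegral_avgCoord_sq_le {n : ℕ} (hn : 0 < n) (t : ℝ) :
    ∫ u in {u | t < avgCoord n u}, avgCoord n u ^ 2 ∂unifCube n ≤ tailP n t := by
  have hn' : (0 : ℝ) < n := by exact_mod_cast hn
  have hc := continuous_avgCoord n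
  have h : ∫ u in {u | t < avgCoord n u}, avgCoord n u ^ 2 ∂unifCube n ≤
      ∫ _ in {u | t < avgCoord n u}, (1 : ℝ) ∂unifCube n := by
    refine integral_mono_ae (integrable_unifCube_of_continuous (by fun_prop)).integrableOn
      (integrable_const _) (ae_restrict_of_ae ?_)
    filter_upwards [ae_mem_Icc_unifCube n] with u hu
    refine (avgCoord_sq_le hn u).trans ((div_le_one hn').2 ?_)
    calc ∑ i, u i ^ 2 ≤ ∑ _i : Fin n, (1 : ℝ) :=
          Finset.sum_le_sum fun i _ => by nlinarith [(hu i).1, (hu i).2]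
      _ = n := by simp
  simpa [tailP, Measure.real] using h

/-- Jensen's inequality for the square under the conditional law given `X > t`. -/
theorem truncMean_sq_mul_tailP_le {n : ℕ} {t : ℝ} (hp : 0 < tailP n t) :
    truncMean n t ^ 2 * tailP n t ≤
      ∫ u in {u | t < avgCoord n u}, avgCoord n u ^ 2 ∂unifCube n := by
  have hc := continuous_avgCoord n
  have hm : ∫ u in {u | t < avgCoord n u}, avgCoord n u ∂unifCube n =
      truncMean n t * tailP n t := (div_mul_cancel₀ _ hp.ne').symm
  set m := truncMean n t
  have h : 0 ≤ ∫ u in {u | t < avgCoord n u},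
      (avgCoord n u ^ 2 - (2 * m * avgCoord n u - m ^ 2)) ∂unifCube n :=
    integral_nonneg fun u => by
      change 0 ≤ avgCoord n u ^ 2 - (2 * m * avgCoord n u - m ^ 2)
      nlinarith [sq_nonneg (avgCoord n u - m)]
  rw [integral_sub (integrable_unifCube_of_continuous (by fun_prop)).integrableOn
    (integrable_unifCube_of_continuous (by fun_prop)).integrableOn,
    integral_sub (integrable_unifCube_of_continuous (by fun_prop)).integrableOn
    (integrable_const _), integral_const_mul, hm] at h
  have hconst : ∫ _ in {u | t < avgCoord n u}, m ^ 2 ∂unifCube n = tailP n t * m ^ 2 := by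
    simp [tailP, Measure.real]
  rw [hconst] at h
  nlinarith

theorem truncMean_mul_sub_le {n : ℕ} (hn : 0 < n) {t : ℝ} (hp : 0 < tailP n t) :
    2 * n * (truncMean n t * (truncMean n t - t)) ≤ 1 - truncMean n t ^ 2 := by
  have hn' : (0 : ℝ) < n := by exact_mod_cast hn
  have hc := continuous_avgCoord n
  have hm : ∫ u in {u | t < avgCoord n u}, avgCoord n u ∂unifCube n =
      truncMean n t * tailP n t := (div_mul_cancel₀ _ hp.ne').symm
  have hJ := truncMean_sq_mul_tailP_le hp
  have h := setIntegral_avgCoord_mul_sub_le hn t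
  have hl : ∫ u in {u | t < avgCoord n u},
      2 * n * (avgCoord n u * (avgCoord n u - t)) ∂unifCube n =
      2 * n * (∫ u in {u | t < avgCoord n u}, avgCoord n u ^ 2 ∂unifCube n) -
        2 * n * t * (truncMean n t * tailP n t) := by
    rw [← hm, ← integral_const_mul, ← integral_const_mul, ← integral_sub
      (integrable_unifCube_of_continuous (by fun_prop)).integrableOn
      (integrable_unifCube_of_continuous (by fun_prop)).integrableOn]
    congr 1
    ext u
    ring
  rw [hl, integral_sub (integrable_const _)
    (integrable_unifCube_of_continuous (by fun_prop)).integrableOn] at h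
  have hconst : ∫ _ in {u | t < avgCoord n u}, (1 : ℝ) ∂unifCube n = tailP n t := by
    simp [tailP, Measure.real]
  rw [hconst] at h
  refine le_of_mul_le_mul_right ?_ hp
  have := mul_le_mul_of_nonneg_left hJ (by positivity : (0 : ℝ) ≤ 2 * n)
  linarith

/-- There is a universal constant `C > 0` such that for the average `X` of `n` i.i.d.
uniform random variables on `[-1,1]` and every `t ∈ (-1,1)`,
`(m_X(t) - t) · m_X(t)/(1 - m_X(t)²) < C/n`. -/
theorem derived_ineq_up_to_constant :
    ∃ C : ℝ, 0 < C ∧ ∀ n : ℕ, 0 < n → ∀ t ∈ Ioo (-1 : ℝ) 1,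
      (truncMean n t - t) * (truncMean n t / (1 - truncMean n t ^ 2)) < C / n := by
  refine ⟨1, one_pos, fun n hn t _ => ?_⟩
  have hn' : (0 : ℝ) < n := by exact_mod_cast hn
  have hbound : (0 : ℝ) < 1 / n := by positivity
  have hp0 : 0 ≤ tailP n t := ENNReal.toReal_nonneg
  rcases hp0.eq_or_lt with hp | hp
  · have hm : truncMean n t = 0 := by rw [truncMean, ← hp, div_zero]
    simpa [hm] using hbound
  have hle : truncMean n t ^ 2 ≤ 1 := by
    refine le_of_mul_le_mul_right ?_ hp
    rw [one_mul]
    exact (truncMean_sq_mul_tailP_le hp).trans (setIntegral_avgCoord_sq_le hn t)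
  rcases hle.eq_or_lt with h1 | h1
  · simpa [h1] using hbound
  have hpos : 0 < 1 - truncMean n t ^ 2 := sub_pos.2 h1
  rw [← mul_div_assoc, div_lt_div_iff₀ hpos hn']
  linarith [truncMean_mul_sub_le hn hp]
end
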